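/- Let p ∈ [3,5), M > 0, and suppose C₁, C_{1/2} > 0 are constants such that for every Schwartz function v : ℝ → ℂ one has ∫_ℝ|v|^{p+1} ≤ C₁ (∫_ℝ|v|²)^{(p+3)/4} (∫_ℝ|v′|²)^{(p−1)/4} and ∫_ℝ|v|^{p+1} ≤ C_{1/2} (∫_ℝ|v|²) (∫_ℝ 2π|ξ| |v̂(ξ)|² dξ)^{(p−1)/2}; set α = (2^{3(p+1)/2}/(p+1)) max{C₁, C_{1/2}}. Let c ≥ (αM)^{(p−1)/(5−p)}. Then every Schwartz function u : ℝ → ℂ with 𝓜(u) = M and K_c(u) ≤ c^{(p+3)/(p−1)} satisfies 𝓔_c(u) ≥ (1/4) · K_c(u)^{(p−1)/4} · ( K_c(u)^{(5−p)/4} − α M^{(p+3)/4} ). -/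

import Mathlib

open Real MeasureTheory SchwartzMap FourierTransform

/-- The symbol of the pseudo-relativistic operator. -/
noncomputable def mSym (c ξ : ℝ) : ℝ := Real.sqrt (c ^ 2 * ξ ^ 2 + c ^ 4 / 4) - c ^ 2 / 2

/-- The mass `𝓜(u)`. -/
noncomputable def massOf (u : ℝ → ℂ) : ℝ := ∫ x : ℝ, ‖u x‖ ^ 2

/-- The relativistic kinetic energy `K_c(u)`. -/
noncomputable def kineticC (c : ℝ) (u : ℝ → ℂ) : ℝ :=
  ∫ ξ : ℝ, mSym c (2 * π * ξ) * ‖𝓕 u ξ‖ ^ 2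

/-- The relativistic energy `𝓔_c(u)`. -/
noncomputable def energyC (c p : ℝ) (u : ℝ → ℂ) : ℝ :=
  (1 / 2) * kineticC c u - (1 / (p + 1)) * ∫ x : ℝ, ‖u x‖ ^ (p + 1)

lemma mSym_lower (c y : ℝ) (hc : 0 < c) : c * y ^ 2 ≤ mSym c y * (|y| + c) := by
  unfold mSym
  set S := Real.sqrt (c ^ 2 * y ^ 2 + c ^ 4 / 4) with hS
  have hS0 : 0 ≤ S := Real.sqrt_nonneg _
  have hS2 : S ^ 2 = c ^ 2 * y ^ 2 + c ^ 4 / 4 := Real.sq_sqrt (by positivity)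
  have hy := abs_nonneg y
  have hyy : |y| ^ 2 = y ^ 2 := sq_abs y
  have h1 : S ≤ c * |y| + c ^ 2 / 2 := by
    apply Real.sqrt_le_iff.mpr
    refine ⟨by positivity, ?_⟩
    nlinarith [mul_nonneg (pow_pos hc 3).le hy]
  have h2 : c ^ 2 / 2 ≤ S := by
    apply Real.le_sqrt_of_sq_le
    nlinarith [mul_nonneg (sq_nonneg c) (sq_nonneg y)]
  have h3 : (S - c ^ 2 / 2) * (S + c ^ 2 / 2) ≤ (S - c ^ 2 / 2) * (c * |y| + c ^ 2) :=
    mul_le_mul_of_nonneg_left (by linarith) (by linarith)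
  have h4 : c * (c * y ^ 2) ≤ c * ((S - c ^ 2 / 2) * (|y| + c)) := by nlinarith
  exact le_of_mul_le_mul_left h4 hc

lemma mSym_nonneg (c y : ℝ) : 0 ≤ mSym c y := by
  unfold mSym
  have : c ^ 2 / 2 ≤ Real.sqrt (c ^ 2 * y ^ 2 + c ^ 4 / 4) := by
    apply Real.le_sqrt_of_sq_le
    nlinarith [mul_nonneg (sq_nonneg c) (sq_nonneg y)]
  linarith

lemma mSym_upper (c y : ℝ) (hc : 0 < c) : mSym c y ≤ c * |y| := by
  unfold mSym
  have hy := abs_nonneg y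
  have hyy : |y| ^ 2 = y ^ 2 := sq_abs y
  have h1 : Real.sqrt (c ^ 2 * y ^ 2 + c ^ 4 / 4) ≤ c * |y| + c ^ 2 / 2 := by
    apply Real.sqrt_le_iff.mpr
    refine ⟨by positivity, ?_⟩
    nlinarith [mul_nonneg (pow_pos hc 3).le hy]
  linarith

lemma mult_low (c y : ℝ) (hc : 0 < c) :
    y ^ 2 * (c ^ 2 / (c ^ 2 + y ^ 2)) ^ 2 ≤ 4 * mSym c y := by
  have h := mSym_lower c y hc
  have hx := abs_nonneg y
  rw [← sq_abs y] at *
  set x := |y|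
  have h1 : c * x ^ 2 / (x + c) ≤ mSym c y := by
    rw [div_le_iff₀ (by positivity)]; exact h
  refine le_trans ?_ (mul_le_mul_of_nonneg_left h1 (by norm_num))
  rw [div_pow, ← mul_div_assoc, ← mul_div_assoc, div_le_div_iff₀ (by positivity) (by positivity)]
  have : c ^ 3 * (x + c) ≤ 4 * (c ^ 2 + x ^ 2) ^ 2 := by
    nlinarith [sq_nonneg (c - x), mul_nonneg (sq_nonneg c) (sq_nonneg (c-x)), sq_nonneg (x^2),
      mul_nonneg (sq_nonneg c) (sq_nonneg x), sq_nonneg (c ^ 2)]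
  nlinarith [mul_le_mul_of_nonneg_left this (by positivity : 0 ≤ c * x ^ 2)]

lemma mult_high (c y : ℝ) (hc : 0 < c) :
    |y| * (1 - c ^ 2 / (c ^ 2 + y ^ 2)) ^ 2 ≤ 2 / c * mSym c y := by
  have h := mSym_lower c y hc
  have hx := abs_nonneg y
  rw [← sq_abs y] at *
  set x := |y|
  have h1 : c * x ^ 2 / (x + c) ≤ mSym c y := by
    rw [div_le_iff₀ (by positivity)]; exact h
  refine le_trans ?_ (mul_le_mul_of_nonneg_left h1 (by positivity))
  have e : 1 - c ^ 2 / (c ^ 2 + x ^ 2) = x ^ 2 / (c ^ 2 + x ^ 2) := by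
    have : c ^ 2 + x ^ 2 ≠ 0 := by positivity
    field_simp; ring
  have e2 : 2 / c * (c * x ^ 2 / (x + c)) = 2 * x ^ 2 / (x + c) := by
    field_simp
  rw [e, e2, div_pow, ← mul_div_assoc, div_le_div_iff₀ (by positivity) (by positivity)]
  have : x ^ 3 * (x + c) ≤ 2 * (c ^ 2 + x ^ 2) ^ 2 := by
    nlinarith [sq_nonneg (c - x), mul_nonneg (sq_nonneg x) (sq_nonneg (c-x)), sq_nonneg (x^2),
      mul_nonneg (sq_nonneg c) (sq_nonneg x), sq_nonneg (c ^ 2)]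
  nlinarith [mul_le_mul_of_nonneg_left this (by positivity : 0 ≤ x ^ 2)]

lemma integrable_weight (v : SchwartzMap ℝ ℂ) (w : ℝ → ℝ) (hw : Continuous w) (A : ℝ) (k : ℕ)
    (h : ∀ x, |w x| ≤ A * ‖x‖ ^ k) : Integrable (fun x => w x * ‖v x‖ ^ 2) := by
  obtain ⟨B, hB⟩ : ∃ B, ∀ x, ‖v x‖ ≤ B := by
    obtain ⟨B, -, hB⟩ := v.decay 0 0
    exact ⟨B, fun x => by simpa using hB x⟩
  refine Integrable.mono' ((v.integrable_pow_mul volume k).const_mul (A * B))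
    (by have := v.continuous; fun_prop) (Filter.Eventually.of_forall fun x => ?_)
  rw [norm_mul, Real.norm_eq_abs, norm_pow, norm_norm]
  have h0 : 0 ≤ A * ‖x‖ ^ k := (abs_nonneg _).trans (h x)
  calc |w x| * ‖v x‖ ^ 2 ≤ (A * ‖x‖ ^ k) * (B * ‖v x‖) := by
        apply mul_le_mul (h x) _ (by positivity) h0
        rw [sq]; exact mul_le_mul_of_nonneg_right (hB x) (norm_nonneg _)
    _ = _ := by ring

lemma integrable_rpow_schwartz (v : SchwartzMap ℝ ℂ) (q : ℝ) (hq : 1 ≤ q) :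
    Integrable (fun x => ‖v x‖ ^ q) := by
  have := (v.memLp (ENNReal.ofReal q) volume).integrable_norm_rpow
    (by simp; linarith) (by simp)
  rwa [ENNReal.toReal_ofReal (by linarith)] at this

lemma add_rpow_le_real (a b q : ℝ) (ha : 0 ≤ a) (hb : 0 ≤ b) (hq : 1 ≤ q) :
    (a + b) ^ q ≤ 2 ^ (q - 1) * (a ^ q + b ^ q) := by
  have := NNReal.rpow_add_le_mul_rpow_add_rpow ⟨a, ha⟩ ⟨b, hb⟩ hq
  exact_mod_cast this

lemma split_rpow (v w : SchwartzMap ℝ ℂ) (q : ℝ) (hq : 1 ≤ q) :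
    (∫ x, ‖(v + w) x‖ ^ q) ≤ 2 ^ (q - 1) * ((∫ x, ‖v x‖ ^ q) + ∫ x, ‖w x‖ ^ q) := by
  rw [← integral_add (integrable_rpow_schwartz v q hq) (integrable_rpow_schwartz w q hq),
    ← integral_const_mul]
  refine integral_mono (integrable_rpow_schwartz _ q hq)
    (((integrable_rpow_schwartz v q hq).add (integrable_rpow_schwartz w q hq)).const_mul _) ?_
  intro x
  refine le_trans ?_ (add_rpow_le_real _ _ q (norm_nonneg (v x)) (norm_nonneg (w x)) hq)
  exact Real.rpow_le_rpow (norm_nonneg _) (norm_add_le _ _) (by linarith)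

lemma mult_temperate (c : ℝ) (hc : 0 < c) :
    (fun ξ : ℝ => ((c ^ 2 / (c ^ 2 + (2 * π * ξ) ^ 2) : ℝ) : ℂ)).HasTemperateGrowth := by
  have h1 := Function.hasTemperateGrowth_one_add_norm_sq_rpow ℝ (-1)
  have h2 : (fun ξ : ℝ => (2 * π / c) * ξ).HasTemperateGrowth := by fun_prop
  have h3 := Function.Complex.hasTemperateGrowth_ofReal.comp (h1.comp h2)
  have e : (fun ξ : ℝ => ((c ^ 2 / (c ^ 2 + (2 * π * ξ) ^ 2) : ℝ) : ℂ))
      = Complex.ofReal ∘ (fun x : ℝ => (1 + ‖x‖ ^ 2) ^ (-1 : ℝ)) ∘ fun ξ => 2 * π / c * ξ := by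
    funext ξ
    simp only [Function.comp]
    rw [Real.rpow_neg_one, Real.norm_eq_abs, sq_abs]
    congr 1
    field_simp
  rw [e]
  exact h3

lemma deriv_plancherel (v : SchwartzMap ℝ ℂ) :
    ∫ x : ℝ, ‖deriv (⇑v) x‖ ^ 2 = ∫ ξ : ℝ, (2 * π * ξ) ^ 2 * ‖𝓕 v ξ‖ ^ 2 := by
  have h := SchwartzMap.integral_norm_sq_fourier (SchwartzMap.derivCLM ℂ ℂ v)
  simp only [SchwartzMap.derivCLM_apply] at h
  rw [← h]
  congr 1
  ext ξ
  have : (𝓕 (SchwartzMap.derivCLM ℂ ℂ v)) ξ = 𝓕 (deriv ⇑v) ξ := by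
    rw [SchwartzMap.fourier_coe]
    rfl
  rw [this, Real.fourier_deriv v.integrable v.differentiable
    (by exact (SchwartzMap.derivCLM ℂ ℂ v).integrable)]
  rw [norm_smul, mul_pow, ← SchwartzMap.fourier_coe]
  congr 1
  simp [mul_pow]

lemma exists_split (c : ℝ) (hc : 0 < c) (u : SchwartzMap ℝ ℂ) :
    ∃ v w : SchwartzMap ℝ ℂ, v + w = u ∧
      (∫ x, ‖v x‖ ^ 2) ≤ massOf u ∧ (∫ x, ‖w x‖ ^ 2) ≤ massOf u ∧
      (∫ x, ‖deriv (⇑v) x‖ ^ 2) ≤ 4 * kineticC c u ∧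
      (∫ ξ : ℝ, 2 * π * |ξ| * ‖𝓕 (⇑w) ξ‖ ^ 2) ≤ 2 / c * kineticC c u := by
  set a : ℝ → ℝ := fun ξ => c ^ 2 / (c ^ 2 + (2 * π * ξ) ^ 2) with ha
  have ha0 : ∀ ξ, 0 ≤ a ξ := fun ξ => by positivity
  have ha1 : ∀ ξ, a ξ ≤ 1 := fun ξ => by
    rw [ha]; simp only
    rw [div_le_one (by positivity)]; nlinarith [sq_nonneg (2 * π * ξ)]
  have hg := mult_temperate c hc
  set v : SchwartzMap ℝ ℂ := 𝓕⁻ (SchwartzMap.smulLeftCLM ℂ (fun ξ => (a ξ : ℂ)) (𝓕 u)) with hv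
  change (fun ξ : ℝ => (a ξ : ℂ)).HasTemperateGrowth at hg
  have hFv : ∀ ξ, ‖𝓕 v ξ‖ ^ 2 = a ξ ^ 2 * ‖𝓕 u ξ‖ ^ 2 := fun ξ => by
    rw [hv, FourierTransform.fourier_fourierInv_eq, SchwartzMap.smulLeftCLM_apply_apply hg,
      norm_smul, mul_pow, Complex.norm_real, Real.norm_eq_abs, sq_abs]
  have hFw : ∀ ξ, ‖𝓕 (u - v) ξ‖ ^ 2 = (1 - a ξ) ^ 2 * ‖𝓕 u ξ‖ ^ 2 := fun ξ => by
    have : 𝓕 (u - v) = 𝓕 u - 𝓕 v := (SchwartzMap.fourierTransformCLM ℂ).map_sub u v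
    rw [this, _root_.sub_apply, hv, FourierTransform.fourier_fourierInv_eq,
      SchwartzMap.smulLeftCLM_apply_apply hg, smul_eq_mul]
    have : 𝓕 u ξ - (a ξ : ℂ) * 𝓕 u ξ = ((1 - a ξ : ℝ) : ℂ) * 𝓕 u ξ := by push_cast; ring
    rw [this, norm_mul, mul_pow, Complex.norm_real, Real.norm_eq_abs, sq_abs]
  have hsq : ∀ f : SchwartzMap ℝ ℂ, Integrable (fun x => ‖f x‖ ^ 2) := fun f => by
    simpa using integrable_weight f (fun _ => 1) continuous_const 1 0 (by simp)
  have hK : Integrable (fun ξ => mSym c (2 * π * ξ) * ‖𝓕 u ξ‖ ^ 2) := by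
    refine integrable_weight (𝓕 u) (fun ξ => mSym c (2 * π * ξ)) (by unfold mSym; fun_prop)
      (c * (2 * π)) 1 (fun x => ?_)
    rw [abs_of_nonneg (mSym_nonneg _ _)]
    refine (mSym_upper c _ hc).trans (le_of_eq ?_)
    rw [abs_mul, abs_of_pos (by positivity : 0 < 2 * π), Real.norm_eq_abs]; ring
  have hKe : kineticC c u = ∫ ξ, mSym c (2 * π * ξ) * ‖𝓕 u ξ‖ ^ 2 := rfl
  have hle : ∀ t : ℝ, 0 ≤ t → t ≤ 1 → ∀ s : ℝ, 0 ≤ s → t ^ 2 * s ≤ s := fun t h0 h1 s hs => by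
    nlinarith [mul_le_mul_of_nonneg_right (pow_le_one₀ h0 h1 : t ^ 2 ≤ 1) hs]
  refine ⟨v, u - v, by abel, ?_, ?_, ?_, ?_⟩
  · rw [massOf, ← SchwartzMap.integral_norm_sq_fourier v, ← SchwartzMap.integral_norm_sq_fourier u]
    refine integral_mono (hsq _) (hsq _) fun ξ => ?_
    simp only [hFv]
    exact hle _ (ha0 ξ) (ha1 ξ) _ (by positivity)
  · rw [massOf, ← SchwartzMap.integral_norm_sq_fourier (u - v),
      ← SchwartzMap.integral_norm_sq_fourier u]
    refine integral_mono (hsq _) (hsq _) fun ξ => ?_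
    simp only [hFw]
    exact hle _ (by linarith [ha1 ξ]) (by linarith [ha0 ξ]) _ (by positivity)
  · rw [deriv_plancherel, hKe, ← integral_const_mul]
    refine integral_mono (integrable_weight (𝓕 v) _ (by fun_prop) ((2 * π) ^ 2) 2 ?_)
      (hK.const_mul 4) fun ξ => ?_
    · intro x
      rw [abs_of_nonneg (by positivity), Real.norm_eq_abs, sq_abs]
      exact (mul_pow _ _ _).le
    · simp only [hFv]
      have := mult_low c (2 * π * ξ) hc
      nlinarith [mul_le_mul_of_nonneg_right this (sq_nonneg ‖𝓕 u ξ‖)]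
  · rw [hKe, ← integral_const_mul]
    refine integral_mono (integrable_weight (𝓕 (u - v)) _ (by fun_prop) (2 * π) 1 ?_)
      (hK.const_mul (2 / c)) fun ξ => ?_
    · intro x
      rw [abs_of_nonneg (by positivity), Real.norm_eq_abs, pow_one]
    · simp only [← SchwartzMap.fourier_coe, hFw]
      have := mult_high c (2 * π * ξ) hc
      rw [abs_mul, abs_of_pos (by positivity : 0 < 2 * π)] at this
      nlinarith [mul_le_mul_of_nonneg_right this (sq_nonneg ‖𝓕 u ξ‖)]

lemma kinetic_nonneg (c : ℝ) (u : ℝ → ℂ) : 0 ≤ kineticC c u :=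
  integral_nonneg fun ξ => mul_nonneg (mSym_nonneg _ _) (by positivity)

theorem energy_lower_bound (p M : ℝ) (hp3 : 3 ≤ p) (hp5 : p < 5) (hM : 0 < M)
    (C₁ Chalf : ℝ) (hC₁ : 0 < C₁) (hChalf : 0 < Chalf)
    (hGN1 : ∀ v : SchwartzMap ℝ ℂ,
      (∫ x : ℝ, ‖v x‖ ^ (p + 1))
        ≤ C₁ * (∫ x : ℝ, ‖v x‖ ^ 2) ^ ((p + 3) / 4)
            * (∫ x : ℝ, ‖deriv (⇑v) x‖ ^ 2) ^ ((p - 1) / 4))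
    (hGN2 : ∀ v : SchwartzMap ℝ ℂ,
      (∫ x : ℝ, ‖v x‖ ^ (p + 1))
        ≤ Chalf * (∫ x : ℝ, ‖v x‖ ^ 2)
            * (∫ ξ : ℝ, 2 * π * |ξ| * ‖𝓕 (⇑v) ξ‖ ^ 2) ^ ((p - 1) / 2))
    (α : ℝ) (hα : α = 2 ^ (3 * (p + 1) / 2) / (p + 1) * max C₁ Chalf)
    (c : ℝ) (hc : (α * M) ^ ((p - 1) / (5 - p)) ≤ c) :
    ∀ u : SchwartzMap ℝ ℂ, massOf (⇑u) = M →
      kineticC c (⇑u) ≤ c ^ ((p + 3) / (p - 1)) →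
      (1 / 4) * kineticC c (⇑u) ^ ((p - 1) / 4) *
          (kineticC c (⇑u) ^ ((5 - p) / 4) - α * M ^ ((p + 3) / 4))
        ≤ energyC c p (⇑u) := by
  intro u hMu hKu
  have hp1 : 0 < p + 1 := by linarith
  have hmax : 0 < max C₁ Chalf := lt_max_of_lt_left hC₁
  have hα0 : 0 < α := by rw [hα]; positivity
  have hc0 : 0 < c := lt_of_lt_of_le (by positivity) hc
  have hK0 := kinetic_nonneg c u
  obtain ⟨v, w, hvw, hv, hw, hdv, hdw⟩ := exists_split c hc0 u
  rw [hMu] at hv hw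
  unfold energyC
  set K := kineticC c u with hK
  have hsplit := split_rpow v w (p + 1) (by linarith)
  rw [hvw, add_sub_cancel_right] at hsplit
  set D := max C₁ Chalf with hD
  have hI1 : (∫ x, ‖v x‖ ^ (p + 1)) ≤ D * M ^ ((p + 3) / 4) * (4 * K) ^ ((p - 1) / 4) := by
    refine (hGN1 v).trans ?_
    have a1 : 0 ≤ ∫ x, ‖v x‖ ^ 2 := integral_nonneg fun x => by positivity
    have a2 : 0 ≤ ∫ x, ‖deriv (⇑v) x‖ ^ 2 := integral_nonneg fun x => by positivity
    have e1 : 0 ≤ (p + 3) / 4 := by linarith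
    have e2 : 0 ≤ (p - 1) / 4 := by linarith
    gcongr
    exact le_max_left _ _
  have hI2 : (∫ x, ‖w x‖ ^ (p + 1)) ≤ D * M * (2 / c * K) ^ ((p - 1) / 2) := by
    refine (hGN2 w).trans ?_
    have a1 : 0 ≤ ∫ x, ‖w x‖ ^ 2 := integral_nonneg fun x => by positivity
    have a2 : 0 ≤ ∫ ξ : ℝ, 2 * π * |ξ| * ‖𝓕 (⇑w) ξ‖ ^ 2 :=
      integral_nonneg fun x => by positivity
    have e2 : 0 ≤ (p - 1) / 2 := by linarith
    gcongr
    exact le_max_right _ _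
  have hα4 : α / 4 = 1 / (p + 1) * (2 ^ p * 2 ^ ((p - 1) / 2)) * D := by
    rw [hα, ← Real.rpow_add two_pos]
    have : (2 : ℝ) ^ (3 * (p + 1) / 2) = 2 ^ (p + (p - 1) / 2) * 4 := by
      rw [show (4 : ℝ) = 2 ^ (2 : ℝ) by norm_num, ← Real.rpow_add two_pos]
      congr 1; ring
    rw [this]; ring
  have h4 : (4 * K) ^ ((p - 1) / 4) = 2 ^ ((p - 1) / 2) * K ^ ((p - 1) / 4) := by
    rw [Real.mul_rpow (by norm_num) hK0, show (4 : ℝ) = 2 ^ (2 : ℝ) by norm_num,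
      ← Real.rpow_mul two_pos.le]
    congr 2; ring
  have h2 : (2 / c * K) ^ ((p - 1) / 2)
      = 2 ^ ((p - 1) / 2) * (K ^ ((p - 1) / 2) / c ^ ((p - 1) / 2)) := by
    rw [div_mul_eq_mul_div, Real.div_rpow (by positivity) hc0.le, Real.mul_rpow two_pos.le hK0]
    ring
  have hKs : K ^ ((p - 1) / 2) = K * K ^ ((p - 3) / 2) := by
    rw [show (p - 1) / 2 = 1 + (p - 3) / 2 by ring,
      Real.rpow_add_of_nonneg hK0 zero_le_one (by linarith), Real.rpow_one]
  have hKb : K ^ ((p - 3) / 2) ≤ c ^ ((p + 3) / (p - 1) * ((p - 3) / 2)) := by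
    rw [Real.rpow_mul hc0.le]
    exact Real.rpow_le_rpow hK0 hKu (by linarith)
  have hαM : α * M ≤ c ^ ((5 - p) / (p - 1)) := by
    have h := Real.rpow_le_rpow (by positivity) hc
      (div_nonneg (by linarith) (by linarith) : 0 ≤ (5 - p) / (p - 1))
    rw [← Real.rpow_mul (by positivity)] at h
    have e : (p - 1) / (5 - p) * ((5 - p) / (p - 1)) = 1 := by
      have : p - 1 ≠ 0 := by linarith
      have : 5 - p ≠ 0 := by linarith
      field_simp
    rwa [e, Real.rpow_one] at h
  have hhigh : α * M * (K ^ ((p - 1) / 2) / c ^ ((p - 1) / 2)) ≤ K := by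
    rw [← mul_div_assoc, div_le_iff₀ (by positivity), hKs]
    have hprod : α * M * K ^ ((p - 3) / 2) ≤ c ^ ((p - 1) / 2) := by
      refine (mul_le_mul hαM hKb (by positivity) (by positivity)).trans (le_of_eq ?_)
      rw [← Real.rpow_add hc0]
      congr 1
      have : p - 1 ≠ 0 := by linarith
      field_simp
      ring
    nlinarith [mul_le_mul_of_nonneg_left hprod hK0]
  have hlast : K ^ ((p - 1) / 4) * K ^ ((5 - p) / 4) = K := by
    rw [← Real.rpow_add_of_nonneg hK0 (by linarith) (by linarith)]
    rw [show (p - 1) / 4 + (5 - p) / 4 = 1 by ring, Real.rpow_one]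
  rw [h4] at hI1
  rw [h2] at hI2
  have hfin : 1 / (p + 1) * (∫ x, ‖u x‖ ^ (p + 1))
      ≤ α / 4 * (M ^ ((p + 3) / 4) * K ^ ((p - 1) / 4))
        + α / 4 * (M * (K ^ ((p - 1) / 2) / c ^ ((p - 1) / 2))) := by
    calc 1 / (p + 1) * (∫ x, ‖u x‖ ^ (p + 1))
        ≤ 1 / (p + 1) * (2 ^ p * (D * M ^ ((p + 3) / 4) * (2 ^ ((p - 1) / 2) * K ^ ((p - 1) / 4))
          + D * M * (2 ^ ((p - 1) / 2) * (K ^ ((p - 1) / 2) / c ^ ((p - 1) / 2))))) := by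
          refine mul_le_mul_of_nonneg_left (hsplit.trans ?_) (by positivity)
          exact mul_le_mul_of_nonneg_left (add_le_add hI1 hI2) (by positivity)
      _ = _ := by rw [hα4]; ring
  have : 1 / 4 * K ^ ((p - 1) / 4) * (K ^ ((5 - p) / 4) - α * M ^ ((p + 3) / 4))
      = 1 / 4 * K - α / 4 * (M ^ ((p + 3) / 4) * K ^ ((p - 1) / 4)) := by
    rw [← hlast]
    conv_lhs => rw [hlast]
    rw [hlast]
    linear_combination (1 / 4) * hlast
  rw [this]
  linarith
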